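/- arXiv:2512.17799 — 6 statements merged into one kernel-verified Lean document; each statement's English description precedes it below -/
import Mathlib

section
/- Let R be a ring and let f1 : A0 → A1 and f2 : A0 → A2 be injective R-linear maps between right R-modules, and let (P, h1, h2) be the pushout of (f1, f2). If f1 is an RD-embedding, i.e. f1(A0) ∩ A1·r = f1(A0)·r for every r ∈ R, then h2 is an RD-embedding, i.e. h2(A2) ∩ P·r = h2(A2)·r for every r ∈ R. -/
/-!
STATEMENT 4: If `f1` is an RD-embedding (its image `N` satisfies `N ∩ A1·r = N·r`
for all `r ∈ R`), then the pushout structure map `h2 : A2 → P` is an RD-embedding.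
(Left-module formulation: `N ∩ r•M = r•N`.)
-/

universe u

/-- A submodule `N` of `M` is an RD-submodule if `N ∩ rM = rN` for every `r : R`. -/
def IsRDSubmodule {R : Type u} [Ring R] {M : Type u} [AddCommGroup M]
    [Module R M] (N : Submodule R M) : Prop :=
  ∀ r : R, ∀ x ∈ N, (∃ m : M, x = r • m) → ∃ n ∈ N, x = r • n

/-- The second structure map `h2 : A2 → P = (A1 × A2) ⧸ I`, `h2 y = (0, y) + I`,
of the pushout of the span `(f1, f2)`, where `I = {(f1 a, -f2 a) : a ∈ A0}`. -/
def pushoutH2 {R : Type u} [Ring R] {A0 A1 A2 : Type u}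
    [AddCommGroup A0] [Module R A0] [AddCommGroup A1] [Module R A1]
    [AddCommGroup A2] [Module R A2]
    (f1 : A0 →ₗ[R] A1) (f2 : A0 →ₗ[R] A2) :
    A2 →ₗ[R] (A1 × A2) ⧸ LinearMap.range (f1.prod (-f2)) :=
  (LinearMap.range (f1.prod (-f2))).mkQ ∘ₗ LinearMap.inr R A1 A2

theorem pushoutH2_apply_eq_smul_mk_iff {R : Type u} [Ring R] {A0 A1 A2 : Type u}
    [AddCommGroup A0] [Module R A0] [AddCommGroup A1] [Module R A1]
    [AddCommGroup A2] [Module R A2] (f1 : A0 →ₗ[R] A1) (f2 : A0 →ₗ[R] A2)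
    (r : R) (p : A1 × A2) (y : A2) :
    pushoutH2 f1 f2 y = r • (LinearMap.range (f1.prod (-f2))).mkQ p ↔
      ∃ a, f1 a = r • -p.1 ∧ y = r • p.2 - f2 a := by
  rw [pushoutH2, LinearMap.comp_apply, ← map_smul, Submodule.mkQ_apply, Submodule.mkQ_apply,
    Submodule.Quotient.eq, LinearMap.mem_range]
  refine exists_congr fun a => ?_
  simp only [LinearMap.prod_apply, Function.prod, LinearMap.neg_apply, LinearMap.inr_apply,
    Prod.ext_iff, Prod.fst_sub, Prod.snd_sub, Prod.smul_fst, Prod.smul_snd, zero_sub, smul_neg]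
  refine and_congr_right fun _ => ⟨fun h => ?_, fun h => ?_⟩
  · rw [sub_eq_add_neg, h, add_sub_cancel]
  · rw [h]; abel

theorem pushoutH2_injective {R : Type u} [Ring R] {A0 A1 A2 : Type u}
    [AddCommGroup A0] [Module R A0] [AddCommGroup A1] [Module R A1]
    [AddCommGroup A2] [Module R A2] (f1 : A0 →ₗ[R] A1) (f2 : A0 →ₗ[R] A2)
    (hf1 : Function.Injective f1) : Function.Injective (pushoutH2 f1 f2) := by
  rw [injective_iff_map_eq_zero]
  intro y hy
  obtain ⟨a, ha, rfl⟩ := (pushoutH2_apply_eq_smul_mk_iff f1 f2 0 0 y).1 (by simpa using hy)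
  have ha0 : a = 0 := hf1 (by simpa using ha)
  simp [ha0]

theorem pushout_of_rd_is_rd
    {R : Type u} [Ring R]
    {A0 A1 A2 : Type u}
    [AddCommGroup A0] [Module R A0] [AddCommGroup A1] [Module R A1]
    [AddCommGroup A2] [Module R A2]
    (f1 : A0 →ₗ[R] A1) (f2 : A0 →ₗ[R] A2)
    (hf1 : Function.Injective f1) (hf2 : Function.Injective f2)
    (hrd : IsRDSubmodule (LinearMap.range f1)) :
    Function.Injective (pushoutH2 f1 f2) ∧
      IsRDSubmodule (LinearMap.range (pushoutH2 f1 f2)) := by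
  refine ⟨pushoutH2_injective f1 f2 hf1, ?_⟩
  rintro r _ ⟨y, rfl⟩ ⟨m, hm⟩
  obtain ⟨p, rfl⟩ := Submodule.mkQ_surjective _ m
  obtain ⟨a, ha, rfl⟩ := (pushoutH2_apply_eq_smul_mk_iff f1 f2 r p y).1 hm
  obtain ⟨_, ⟨b, rfl⟩, hb⟩ := hrd r (f1 a) ⟨a, rfl⟩ ⟨-p.1, ha⟩
  obtain rfl : a = r • b := hf1 (by rw [hb, map_smul])
  refine ⟨pushoutH2 f1 f2 (p.2 - f2 b), ⟨_, rfl⟩, ?_⟩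
  rw [← map_smul, smul_sub, map_smul f2]
end

section
/- Let R be an integral domain which is not a field, let Q be its field of fractions, and let φ : R → Q be the canonical map. Let I = {(φ(r), -φ(r)) : r ∈ R} ⊆ Q × Q (an R-submodule of Q × Q, viewed as an R-module) and let P = (Q × Q)/I. Then P is not a torsion-free R-module: there exist x ∈ P with x ≠ 0 and r ∈ R with r ≠ 0 such that x·r = 0. -/
/-!
STATEMENT 5: For an integral domain `R` which is not a field, with fraction field
`Q` and canonical map `φ : R → Q`, the module `P = (Q × Q) ⧸ I`, where
`I = {(φ r, -φ r) : r ∈ R}`, is not torsion-free: there are `x ≠ 0` in `P` and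
`r ≠ 0` in `R` with `r • x = 0`.
-/

universe u

theorem pushout_of_fraction_field_not_torsionFree
    {R : Type u} [CommRing R] [IsDomain R] (hR : ¬IsField R) :
    ∃ x : (FractionRing R × FractionRing R) ⧸
        LinearMap.range ((Algebra.linearMap R (FractionRing R)).prod
          (-(Algebra.linearMap R (FractionRing R)))),
      x ≠ 0 ∧ ∃ r : R, r ≠ 0 ∧ r • x = 0 := by
  obtain ⟨r, hr, hu⟩ := Ring.exists_not_isUnit_of_not_isField hR
  have hr' : algebraMap R (FractionRing R) r ≠ 0 := by
    simpa using hr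
  refine ⟨Submodule.Quotient.mk
    ((algebraMap R (FractionRing R) r)⁻¹, -(algebraMap R (FractionRing R) r)⁻¹), ?_, r, hr, ?_⟩
  · rw [Ne, Submodule.Quotient.mk_eq_zero]
    rintro ⟨s, hs⟩
    have h : algebraMap R (FractionRing R) s = (algebraMap R (FractionRing R) r)⁻¹ :=
      congrArg Prod.fst hs
    refine hu (IsUnit.of_mul_eq_one s (IsFractionRing.injective R (FractionRing R) ?_))
    rw [map_mul, h, mul_inv_cancel₀ hr', map_one]
  · rw [← Submodule.Quotient.mk_smul, Submodule.Quotient.mk_eq_zero]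
    refine ⟨1, ?_⟩
    ext <;> simp [Algebra.smul_def, hr]
end

section
/- Let R be an integral domain. Given torsion-free R-modules A0, A1, A2 and injective R-linear maps f1 : A0 → A1 and f2 : A0 → A2, there exist a torsion-free R-module A3 and injective R-linear maps g1 : A1 → A3 and g2 : A2 → A3 such that g1 ∘ f1 = g2 ∘ f2. (That is, the class of torsion-free modules over an integral domain, with arbitrary embeddings, has the amalgamation property; an amalgam is obtained as the quotient of the pushout by its torsion submodule.) -/
/-!
STATEMENT 6: Over an integral domain, the class of torsion-free modules with
arbitrary embeddings has the amalgamation property.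
-/

universe u

open scoped nonZeroDivisors in
/-- An element of `M` whose class in `M ⧸ N` becomes zero modulo torsion has a nonzero multiple
in `N`. -/
theorem Submodule.exists_smul_mem_of_mkQ_torsion_mkQ_eq_zero {R M : Type*} [CommRing R]
    [AddCommGroup M] [Module R M] (N : Submodule R M) {x : M}
    (h : (Submodule.torsion R (M ⧸ N)).mkQ (N.mkQ x) = 0) : ∃ r : R⁰, (r : R) • x ∈ N := by
  rw [Submodule.mkQ_apply, Submodule.Quotient.mk_eq_zero, Submodule.mem_torsion_iff] at h
  obtain ⟨r, hr⟩ := h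
  refine ⟨r, (Submodule.Quotient.mk_eq_zero N).1 ?_⟩
  rw [Submodule.Quotient.mk_smul]
  exact hr

theorem torsionFree_amalgamation
    {R : Type u} [CommRing R] [IsDomain R]
    {A0 A1 A2 : Type u}
    [AddCommGroup A0] [Module R A0] [AddCommGroup A1] [Module R A1]
    [AddCommGroup A2] [Module R A2]
    [NoZeroSMulDivisors R A0] [NoZeroSMulDivisors R A1] [NoZeroSMulDivisors R A2]
    (f1 : A0 →ₗ[R] A1) (f2 : A0 →ₗ[R] A2)
    (hf1 : Function.Injective f1) (hf2 : Function.Injective f2) :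
    ∃ A3 : ModuleCat.{u} R, NoZeroSMulDivisors R A3 ∧
      ∃ (g1 : A1 →ₗ[R] A3) (g2 : A2 →ₗ[R] A3),
        Function.Injective g1 ∧ Function.Injective g2 ∧ g1 ∘ₗ f1 = g2 ∘ₗ f2 := by
  let N : Submodule R (A1 × A2) := LinearMap.range (f1.prod (-f2))
  let π := (Submodule.torsion R ((A1 × A2) ⧸ N)).mkQ ∘ₗ N.mkQ
  refine ⟨ModuleCat.of R (((A1 × A2) ⧸ N) ⧸ Submodule.torsion R ((A1 × A2) ⧸ N)),
    ⟨fun {_ _} h ↦ smul_eq_zero.1 h⟩,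
    π ∘ₗ LinearMap.inl R A1 A2, π ∘ₗ LinearMap.inr R A1 A2, ?_, ?_, ?_⟩
  · refine (injective_iff_map_eq_zero _).2 fun a ha ↦ ?_
    obtain ⟨r, c, hc⟩ := N.exists_smul_mem_of_mkQ_torsion_mkQ_eq_zero ha
    obtain ⟨h1, h2⟩ := Prod.ext_iff.1 hc
    have hc0 : c = 0 := hf2 (by simpa using h2)
    have hra : (r : R) • a = 0 := by simpa [hc0] using h1.symm
    exact (eq_zero_or_eq_zero_of_smul_eq_zero hra).resolve_left (nonZeroDivisors.coe_ne_zero r)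
  · refine (injective_iff_map_eq_zero _).2 fun a ha ↦ ?_
    obtain ⟨r, c, hc⟩ := N.exists_smul_mem_of_mkQ_torsion_mkQ_eq_zero ha
    obtain ⟨h1, h2⟩ := Prod.ext_iff.1 hc
    have hc0 : c = 0 := hf1 (by simpa using h1)
    have hra : (r : R) • a = 0 := by simpa [hc0] using h2.symm
    exact (eq_zero_or_eq_zero_of_smul_eq_zero hra).resolve_left (nonZeroDivisors.coe_ne_zero r)
  · ext c
    refine congrArg (Submodule.torsion R ((A1 × A2) ⧸ N)).mkQ
      ((Submodule.Quotient.eq N).2 ⟨c, ?_⟩)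
    simp
end

section
/- Let R be an integral domain. Given flat R-modules A0, A1, A2 and injective R-linear maps f1 : A0 → A1 and f2 : A0 → A2, there exist a flat R-module A3 and injective R-linear maps g1 : A1 → A3 and g2 : A2 → A3 such that g1 ∘ f1 = g2 ∘ f2. (That is, the class of flat modules over an integral domain, with arbitrary embeddings, has the amalgamation property; an amalgam is obtained inside a Q-vector space, where Q is the fraction field, by passing from the pushout to its quotient by torsion and tensoring with Q.) -/
/-!
STATEMENT 7: Over an integral domain, the class of flat modules with arbitrary
embeddings has the amalgamation property.
-/

universe u

open TensorProduct

/-- A flat module over a domain embeds in its base change to the fraction field. -/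
theorem Module.Flat.mk_one_injective_fractionRing (R M : Type*) [CommRing R] [IsDomain R]
    [AddCommGroup M] [Module R M] [Module.Flat R M] :
    Function.Injective (TensorProduct.mk R (FractionRing R) M 1) := by
  have h := Module.Flat.rTensor_preserves_injective_linearMap (M := M)
    (Algebra.linearMap R (FractionRing R)) (IsFractionRing.injective R (FractionRing R))
  have hmk : TensorProduct.mk R (FractionRing R) M 1 =
      (Algebra.linearMap R (FractionRing R)).rTensor M ∘ₗ
        (TensorProduct.lid R M).symm.toLinearMap := by
    ext m
    simp
  rw [hmk]
  exact h.comp (TensorProduct.lid R M).symm.injective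

/-- The base change to the fraction field of an injective linear map has a left inverse. -/
theorem LinearMap.exists_leftInverse_baseChange_fractionRing {R M N : Type*} [CommRing R]
    [IsDomain R] [AddCommGroup M] [Module R M] [AddCommGroup N] [Module R N]
    (f : M →ₗ[R] N) (hf : Function.Injective f) :
    ∃ r : FractionRing R ⊗[R] N →ₗ[FractionRing R] FractionRing R ⊗[R] M,
      r ∘ₗ f.baseChange (FractionRing R) = LinearMap.id := by
  have : Module.Flat R (FractionRing R) := IsLocalization.flat _ (nonZeroDivisors R)
  exact LinearMap.exists_leftInverse_of_injective _ (LinearMap.ker_eq_bot.mpr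
    (Module.Flat.lTensor_preserves_injective_linearMap (M := FractionRing R) f hf))

theorem flat_amalgamation
    {R : Type u} [CommRing R] [IsDomain R]
    {A0 A1 A2 : Type u}
    [AddCommGroup A0] [Module R A0] [AddCommGroup A1] [Module R A1]
    [AddCommGroup A2] [Module R A2]
    [Module.Flat R A0] [Module.Flat R A1] [Module.Flat R A2]
    (f1 : A0 →ₗ[R] A1) (f2 : A0 →ₗ[R] A2)
    (hf1 : Function.Injective f1) (hf2 : Function.Injective f2) :
    ∃ A3 : ModuleCat.{u} R, Module.Flat R A3 ∧
      ∃ (g1 : A1 →ₗ[R] A3) (g2 : A2 →ₗ[R] A3),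
        Function.Injective g1 ∧ Function.Injective g2 ∧ g1 ∘ₗ f1 = g2 ∘ₗ f2 := by
  let Q := FractionRing R
  have : Module.Flat R Q := IsLocalization.flat _ (nonZeroDivisors R)
  obtain ⟨r1, hr1⟩ := f1.exists_leftInverse_baseChange_fractionRing hf1
  obtain ⟨r2, hr2⟩ := f2.exists_leftInverse_baseChange_fractionRing hf2
  let g1 : Q ⊗[R] A1 →ₗ[Q] (Q ⊗[R] A1) × (Q ⊗[R] A2) :=
    LinearMap.id.prod (f2.baseChange Q ∘ₗ r1)
  let g2 : Q ⊗[R] A2 →ₗ[Q] (Q ⊗[R] A1) × (Q ⊗[R] A2) :=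
    (f1.baseChange Q ∘ₗ r2).prod LinearMap.id
  refine ⟨ModuleCat.of R ((Q ⊗[R] A1) × (Q ⊗[R] A2)), Module.Flat.trans R Q _,
    g1.restrictScalars R ∘ₗ TensorProduct.mk R Q A1 1,
    g2.restrictScalars R ∘ₗ TensorProduct.mk R Q A2 1, ?_, ?_, ?_⟩
  · exact fun x y h => Module.Flat.mk_one_injective_fractionRing R A1 (congrArg Prod.fst h)
  · exact fun x y h => Module.Flat.mk_one_injective_fractionRing R A2 (congrArg Prod.snd h)
  · refine LinearMap.ext fun x => Prod.ext ?_ ?_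
    · have h2 : r2 (1 ⊗ₜ f2 x) = 1 ⊗ₜ x := LinearMap.congr_fun hr2 (1 ⊗ₜ x)
      exact (congrArg (f1.baseChange Q) h2).symm
    · have h1 : r1 (1 ⊗ₜ f1 x) = 1 ⊗ₜ x := LinearMap.congr_fun hr1 (1 ⊗ₜ x)
      exact congrArg (f2.baseChange Q) h1
end

section
/- Let R be an integral domain with fraction field Q, and let r ∈ R be such that neither r nor 1 - r is a unit of R (such r exists whenever R is not local). Regard Q × Q as an R-module, and let u = (r⁻¹, 1), v = (1, r⁻¹) ∈ Q × Q. Let J = R·u + R·v and A3 = {(a·r⁻¹, b·r⁻¹) : a, b ∈ R} ⊆ Q × Q. Then: (i) u and v are R-linearly independent, so the R-linear map t : R² → Q² with t(1,0) = u, t(0,1) = v is injective; (ii) J ⊆ A3; (iii) (r⁻¹, -r⁻¹) ∈ A3 but (r⁻¹, -r⁻¹) ∉ J; (iv) J is not an RD-submodule of A3: the element u - v lies in J ∩ A3·(1-r) but not in J·(1-r). In particular, J is not a pure submodule of A3. -/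
/-!
STATEMENT 8: Over an integral domain `R` with fraction field `Q` and `r ∈ R` such
that neither `r` nor `1 - r` is a unit, with `u = (r⁻¹, 1)`, `v = (1, r⁻¹)` in
`Q × Q`, `J = R·u + R·v` and `A3 = {(a·r⁻¹, b·r⁻¹) : a, b ∈ R}`:
(i) `u, v` are `R`-linearly independent and the map `(a,b) ↦ a•u + b•v` is
injective; (ii) `J ⊆ A3`; (iii) `(r⁻¹, -r⁻¹) ∈ A3 \ J`; (iv) `u - v` lies in
`J ∩ A3·(1-r)` but not in `J·(1-r)`.
-/

universe u

/-- The element `u = (r⁻¹, 1)` of `Q × Q`. -/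
noncomputable def uElt (R : Type u) [CommRing R] [IsDomain R] (r : R) :
    FractionRing R × FractionRing R :=
  ((algebraMap R (FractionRing R) r)⁻¹, 1)

/-- The element `v = (1, r⁻¹)` of `Q × Q`. -/
noncomputable def vElt (R : Type u) [CommRing R] [IsDomain R] (r : R) :
    FractionRing R × FractionRing R :=
  (1, (algebraMap R (FractionRing R) r)⁻¹)

/-- The submodule `J = R·u + R·v` of `Q × Q`. -/
noncomputable def Jmod (R : Type u) [CommRing R] [IsDomain R] (r : R) :
    Submodule R (FractionRing R × FractionRing R) :=
  Submodule.span R {uElt R r, vElt R r}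

/-- The set `A3 = {(a·r⁻¹, b·r⁻¹) : a, b ∈ R} ⊆ Q × Q`. -/
noncomputable def A3set (R : Type u) [CommRing R] [IsDomain R] (r : R) :
    Set (FractionRing R × FractionRing R) :=
  {p | ∃ a b : R,
    p = (algebraMap R (FractionRing R) a * (algebraMap R (FractionRing R) r)⁻¹,
         algebraMap R (FractionRing R) b * (algebraMap R (FractionRing R) r)⁻¹)}

/-- Over the denominator `r`, the combination `a • u + b • v` has numerators `a + b * r` and
`a * r + b`. -/
theorem smul_uElt_add_smul_vElt {R : Type u} [CommRing R] [IsDomain R] {r : R} (hr : r ≠ 0)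
    (a b : R) :
    a • uElt R r + b • vElt R r =
      (algebraMap R (FractionRing R) (a + b * r) * (algebraMap R (FractionRing R) r)⁻¹,
       algebraMap R (FractionRing R) (a * r + b) * (algebraMap R (FractionRing R) r)⁻¹) := by
  have hr' : algebraMap R (FractionRing R) r ≠ 0 := by simpa using hr
  ext <;> simp only [uElt, vElt, Prod.fst_add, Prod.snd_add, Prod.smul_fst, Prod.smul_snd,
    map_add, map_mul] <;> simp only [Algebra.smul_def] <;> field_simp

theorem algebraMap_mul_inv_pair_inj {R : Type u} [CommRing R] [IsDomain R] {r : R} (hr : r ≠ 0)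
    {a b c d : R}
    (h : (algebraMap R (FractionRing R) a * (algebraMap R (FractionRing R) r)⁻¹,
          algebraMap R (FractionRing R) b * (algebraMap R (FractionRing R) r)⁻¹) =
         (algebraMap R (FractionRing R) c * (algebraMap R (FractionRing R) r)⁻¹,
          algebraMap R (FractionRing R) d * (algebraMap R (FractionRing R) r)⁻¹)) :
    a = c ∧ b = d := by
  have hr' : (algebraMap R (FractionRing R) r)⁻¹ ≠ 0 := by simpa using hr
  obtain ⟨h₁, h₂⟩ := Prod.ext_iff.1 h
  exact ⟨IsFractionRing.injective R (FractionRing R) (mul_right_cancel₀ hr' h₁),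
    IsFractionRing.injective R (FractionRing R) (mul_right_cancel₀ hr' h₂)⟩

theorem linearIndependent_uElt_vElt {R : Type u} [CommRing R] [IsDomain R] {r : R}
    (hr₀ : r ≠ 0) (hr : ¬IsUnit r) : LinearIndependent R ![uElt R r, vElt R r] := by
  rw [LinearIndependent.pair_iff]
  intro a b h
  obtain ⟨h₁, h₂⟩ := algebraMap_mul_inv_pair_inj (c := 0) (d := 0) hr₀
    ((smul_uElt_add_smul_vElt hr₀ a b).symm.trans (by rw [h, map_zero, zero_mul]; rfl))
  have hsq : 1 - r * r ≠ 0 := fun h => hr (IsUnit.of_mul_eq_one r (by linear_combination -h))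
  have ha : a = 0 := (mul_eq_zero.1 (by linear_combination h₁ - r * h₂ :
    a * (1 - r * r) = 0)).resolve_right hsq
  exact ⟨ha, by simpa [ha] using h₂⟩

theorem inv_neg_inv_notMem_Jmod {R : Type u} [CommRing R] [IsDomain R] {r : R}
    (hr₀ : r ≠ 0) (hr : ¬IsUnit r) (h1r : ¬IsUnit (1 - r)) :
    ((algebraMap R (FractionRing R) r)⁻¹, -(algebraMap R (FractionRing R) r)⁻¹) ∉ Jmod R r := by
  intro h
  obtain ⟨a, b, h⟩ := Submodule.mem_span_pair.1 h
  obtain ⟨h₁, h₂⟩ := algebraMap_mul_inv_pair_inj (c := 1) (d := -1) hr₀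
    ((smul_uElt_add_smul_vElt hr₀ a b).symm.trans (by simpa using h))
  have hne : 1 + r ≠ 0 := fun h => hr (IsUnit.of_mul_eq_one (-1) (by linear_combination -h))
  have hab : a + b = 0 := (mul_eq_zero.1 (by linear_combination h₁ + h₂ :
    (a + b) * (1 + r) = 0)).resolve_right hne
  exact h1r (IsUnit.of_mul_eq_one a (by linear_combination h₁ - r * hab))

theorem uElt_sub_vElt {R : Type u} [CommRing R] [IsDomain R] {r : R} (hr : r ≠ 0) :
    uElt R r - vElt R r = (1 - r) •
      ((algebraMap R (FractionRing R) r)⁻¹, -(algebraMap R (FractionRing R) r)⁻¹) := by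
  have hr' : algebraMap R (FractionRing R) r ≠ 0 := by simpa using hr
  ext <;> simp only [uElt, vElt, Prod.fst_sub, Prod.snd_sub, Prod.smul_fst, Prod.smul_snd] <;>
    simp only [Algebra.smul_def, map_sub, map_one] <;> field_simp
  ring

theorem not_RD_submodule_example
    {R : Type u} [CommRing R] [IsDomain R] {r : R}
    (hr : ¬IsUnit r) (h1r : ¬IsUnit (1 - r)) :
    LinearIndependent R ![uElt R r, vElt R r] ∧
    Function.Injective (fun p : R × R => p.1 • uElt R r + p.2 • vElt R r) ∧
    (Jmod R r : Set (FractionRing R × FractionRing R)) ⊆ A3set R r ∧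
    (((algebraMap R (FractionRing R) r)⁻¹, -(algebraMap R (FractionRing R) r)⁻¹)
        ∈ A3set R r) ∧
    (((algebraMap R (FractionRing R) r)⁻¹, -(algebraMap R (FractionRing R) r)⁻¹)
        ∉ Jmod R r) ∧
    uElt R r - vElt R r ∈ Jmod R r ∧
    (∃ y ∈ A3set R r, uElt R r - vElt R r = (1 - r) • y) ∧
    ¬(∃ z ∈ Jmod R r, uElt R r - vElt R r = (1 - r) • z) := by
  have hr₀ : r ≠ 0 := by
    rintro rfl
    simp at h1r
  have h1r₀ : 1 - r ≠ 0 := fun h => hr (by simp [← sub_eq_zero.1 h])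
  have hli := linearIndependent_uElt_vElt hr₀ hr
  have hA : ((algebraMap R (FractionRing R) r)⁻¹, -(algebraMap R (FractionRing R) r)⁻¹)
      ∈ A3set R r := ⟨1, -1, by simp⟩
  have hJ := inv_neg_inv_notMem_Jmod hr₀ hr h1r
  refine ⟨hli, ?_, ?_, hA, hJ, ?_, ⟨_, hA, uElt_sub_vElt hr₀⟩, ?_⟩
  · rintro ⟨a, b⟩ ⟨c, d⟩ h
    obtain ⟨h₁, h₂⟩ := LinearIndependent.pair_iff.1 hli (a - c) (b - d) (by
      rw [sub_smul, sub_smul, sub_add_sub_comm]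
      exact sub_eq_zero.2 h)
    exact Prod.ext (sub_eq_zero.1 h₁) (sub_eq_zero.1 h₂)
  · intro p hp
    obtain ⟨a, b, rfl⟩ := Submodule.mem_span_pair.1 hp
    exact ⟨_, _, smul_uElt_add_smul_vElt hr₀ a b⟩
  · exact sub_mem (Submodule.subset_span (by simp)) (Submodule.subset_span (by simp))
  · rintro ⟨z, hz, h⟩
    rw [uElt_sub_vElt hr₀] at h
    exact hJ (smul_right_injective _ h1r₀ h ▸ hz)
end

section
/- Let R be a ring, κ an infinite cardinal, A a right R-module, and H a family of submodules of A such that: (i) H is closed under arbitrary sums, i.e. for every subfamily S ⊆ H the submodule sum Σ S belongs to H; and (ii) for every finite subset X of A there exists P ∈ H with X ⊆ P and |P| ≤ κ. Then for every submodule B of A there exists C ∈ H with B ⊆ C and |C| ≤ |B| + κ. -/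
/-!
STATEMENT 9: Abstract Hill-family property. If `H` is a family of submodules of `A`
closed under arbitrary sums such that every finite subset of `A` is contained in a
member of `H` of cardinality at most `κ` (with `κ` infinite), then every submodule
`B` of `A` is contained in a member `C` of `H` with `|C| ≤ |B| + κ`.
-/

universe u

open Cardinal

/-- The supremum of a family of submodules is no larger than the set of finite sequences of
elements of its members. -/
theorem mk_iSup_submodule_le {R : Type u} [Ring R] {A : Type u} [AddCommGroup A] [Module R A]
    {ι : Type u} (P : ι → Submodule R A) :
    #↥(⨆ i, P i) ≤ max ℵ₀ #(Σ i, ↥(P i)) := by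
  let f : List (Σ i, ↥(P i)) → A := fun l => (l.map fun p => (p.2 : A)).sum
  have hf : ((⨆ i, P i : Submodule R A) : Set A) ⊆ Set.range f := by
    intro x hx
    refine Submodule.iSup_induction P (motive := fun x => x ∈ Set.range f) hx ?_ ?_ ?_
    · intro i y hy
      exact ⟨[⟨i, y, hy⟩], by simp [f]⟩
    · exact ⟨[], by simp [f]⟩
    · rintro _ _ ⟨l, rfl⟩ ⟨m, rfl⟩
      exact ⟨l ++ m, by simp [f]⟩
  exact (mk_le_mk_of_subset hf).trans (mk_range_le.trans (mk_list_le_max _))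

theorem hill_family_small_extension
    {R : Type u} [Ring R] {A : Type u} [AddCommGroup A] [Module R A]
    (κ : Cardinal.{u}) (hκ : ℵ₀ ≤ κ)
    (H : Set (Submodule R A))
    (hsup : ∀ S : Set (Submodule R A), S ⊆ H → sSup S ∈ H)
    (hsmall : ∀ X : Finset A, ∃ P ∈ H, (X : Set A) ⊆ (P : Set A) ∧ #↥P ≤ κ)
    (B : Submodule R A) :
    ∃ C ∈ H, B ≤ C ∧ #↥C ≤ #↥B + κ := by
  choose P hPH hbP hPκ using fun b : B => hsmall {(b : A)}
  refine ⟨⨆ b, P b, hsup _ (Set.range_subset_iff.2 hPH), ?_, ?_⟩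
  · intro b hb
    exact Submodule.mem_iSup_of_mem ⟨b, hb⟩ (hbP ⟨b, hb⟩ (by simp))
  · refine (mk_iSup_submodule_le P).trans (max_le (hκ.trans (self_le_add_left _ _)) ?_)
    calc #(Σ b, ↥(P b)) = Cardinal.sum fun b => #↥(P b) := mk_sigma _
      _ ≤ Cardinal.sum fun _ : B => κ := sum_le_sum _ _ hPκ
      _ = #↥B * κ := sum_const' _ _
      _ ≤ max #↥B κ := mul_le_max_of_aleph0_le_right hκ
      _ ≤ #↥B + κ := max_le (self_le_add_right _ _) (self_le_add_left _ _)
end
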